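/- Let p be an odd prime and let m, d be integers with p ∤ m·d·(m+d). Then ∑_{l=1}^{(p-1)/2} (binom(2l,l)^2/16^l) · ∑_{k=1}^{l} (1/(k·binom(2k,k)))·(-(m-d)^2/(m·d))^k ≡ ((d-m)/(d+m))·(-1/p)·( S_{p-1}((m+d)/(4m)) − S_{p-1}((m+d)/(4d)) ) (mod p), where (-1/p) = (-1)^{(p-1)/2} is the Legendre symbol; all quantities are p-adic integers. -/

import Mathlib

/-- `S_{p-1}(x) = ∑_{k=1}^{p-1} binom(2k,k) x^k / k`. -/
noncomputable def Ssum (p : ℕ) [Fact p.Prime] (x : ℚ_[p]) : ℚ_[p] :=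
  ∑ k ∈ Finset.Icc 1 (p - 1), ((2 * k).choose k : ℚ_[p]) * x ^ k / (k : ℚ_[p])

theorem sum_Icc_one_eq_sum_range {M : Type*} [AddCommMonoid M] (f : ℕ → M) (N : ℕ) :
    ∑ k ∈ Finset.Icc 1 N, f k = ∑ k ∈ Finset.range N, f (k + 1) := by
  induction N with
  | zero => simp
  | succ N ih => rw [Finset.sum_Icc_succ_top (by omega), ih, Finset.sum_range_succ]

theorem sum_sub_succ_mul_sum_Icc {R : Type*} [CommRing R] (G h : ℕ → R) (N : ℕ) :
    ∑ l ∈ Finset.Icc 1 N, (G l - G (l + 1)) * ∑ k ∈ Finset.Icc 1 l, h k =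
      ∑ k ∈ Finset.Icc 1 N, G k * h k - G (N + 1) * ∑ k ∈ Finset.Icc 1 N, h k := by
  induction N with
  | zero => simp
  | succ N ih =>
    simp only [Finset.sum_Icc_succ_top (show 1 ≤ N + 1 by omega)] at ih ⊢
    rw [ih]
    ring

/-- The partial fractions of `∑ (-1)^k * choose n k * u^k / k`, summed up to any `N ≥ n`. -/
theorem sum_choose_mul_neg_pow_div {K : Type*} [Field K] [CharZero K] (u : K) {n N : ℕ}
    (hn : n ≤ N) :
    ∑ k ∈ Finset.Icc 1 N, (-1) ^ k * (n.choose k : K) * u ^ k / k =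
      ∑ j ∈ Finset.Icc 1 n, ((1 - u) ^ j - 1) / j := by
  induction n with
  | zero =>
    simp only [sum_Icc_one_eq_sum_range]
    simp
  | succ n ih =>
    rw [Finset.sum_Icc_succ_top (by omega), ← ih (by omega), ← sub_eq_iff_eq_add',
      ← Finset.sum_sub_distrib]
    have hbin : (1 - u) ^ (n + 1) - 1 =
        ∑ k ∈ Finset.range N, (-1) ^ (k + 1) * ((n + 1).choose (k + 1) : K) * u ^ (k + 1) := by
      rw [← Finset.sum_subset (Finset.range_mono hn) (by
          intro k _ hk
          rw [Nat.choose_eq_zero_of_lt (by simp at hk; omega)]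
          simp),
        sub_eq_iff_eq_add, sub_eq_neg_add, add_pow, Finset.sum_range_succ']
      simp only [one_pow, pow_zero, Nat.choose_zero_right, neg_pow u]
      simp [mul_right_comm]
    rw [hbin, sum_Icc_one_eq_sum_range, Finset.sum_div]
    refine Finset.sum_congr rfl fun k _ => ?_
    have h := Nat.add_one_mul_choose_eq n k
    have h' : ((n : K) + 1) * (n.choose k : K) = ((n + 1).choose (k + 1) : K) * (k + 1) := by
      exact_mod_cast h
    have hk : (k : K) + 1 ≠ 0 := by exact_mod_cast k.succ_ne_zero
    have hn' : (n : K) + 1 ≠ 0 := by exact_mod_cast n.succ_ne_zero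
    rw [Nat.choose_succ_succ] at h' ⊢
    push_cast at h' ⊢
    field_simp
    linear_combination (u ^ (k + 1)) * h'

/-- The Chebyshev-type sums attached to `t + t⁻¹`. -/
theorem sum_choose_mul_sq_div_pow {K : Type*} [Field K] {t : K} (ht : t ≠ 0) (ht1 : t + 1 ≠ 0)
    {n N : ℕ} (hn : n ≤ N) :
    ∑ k ∈ Finset.range N, ((n + k).choose (2 * k + 1) : K) * ((t - 1) ^ 2 / t) ^ (k + 1) =
        (t - 1) / (t + 1) * (t ^ n - t⁻¹ ^ n) ∧
      ∑ k ∈ Finset.range (N + 1), ((n + k).choose (2 * k) : K) * ((t - 1) ^ 2 / t) ^ k =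
        (t ^ (n + 1) + t⁻¹ ^ n) / (t + 1) := by
  induction n with
  | zero =>
    constructor
    · rw [Finset.sum_eq_zero fun k _ => by rw [Nat.choose_eq_zero_of_lt (by omega)]; simp]
      simp
    · rw [Finset.sum_range_succ', Finset.sum_eq_zero fun k _ => by
        rw [Nat.choose_eq_zero_of_lt (by omega)]; simp]
      simp [ht1]
  | succ n ih =>
    obtain ⟨hP, hQ⟩ := ih (by omega)
    have hP' : ∑ k ∈ Finset.range N,
        ((n + 1 + k).choose (2 * k + 1) : K) * ((t - 1) ^ 2 / t) ^ (k + 1) =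
        (t - 1) / (t + 1) * (t ^ (n + 1) - t⁻¹ ^ (n + 1)) := by
      rw [Finset.sum_range_succ, Nat.choose_eq_zero_of_lt (show n + N < 2 * N by omega)] at hQ
      calc _ = ∑ k ∈ Finset.range N,
              ((n + k).choose (2 * k + 1) : K) * ((t - 1) ^ 2 / t) ^ (k + 1) +
            (t - 1) ^ 2 / t * (∑ k ∈ Finset.range N,
              ((n + k).choose (2 * k) : K) * ((t - 1) ^ 2 / t) ^ k) := by
            rw [Finset.mul_sum, ← Finset.sum_add_distrib]
            refine Finset.sum_congr rfl fun k _ => ?_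
            rw [add_right_comm, Nat.choose_succ_succ]
            push_cast
            ring
        _ = _ := by
            rw [hP]
            simp only [Nat.cast_zero, zero_mul, add_zero] at hQ
            rw [hQ]
            simp only [inv_pow]
            field_simp
            ring
    refine ⟨hP', ?_⟩
    calc _ = ∑ k ∈ Finset.range (N + 1),
            ((n + k).choose (2 * k) : K) * ((t - 1) ^ 2 / t) ^ k +
          ∑ k ∈ Finset.range N,
            ((n + 1 + k).choose (2 * k + 1) : K) * ((t - 1) ^ 2 / t) ^ (k + 1) := by
          rw [Finset.sum_range_succ', Finset.sum_range_succ' _ N,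
            add_right_comm (∑ k ∈ _, _) _ (∑ k ∈ _, _),
            ← Finset.sum_add_distrib]
          congr 1
          · refine Finset.sum_congr rfl fun k _ => ?_
            rw [show n + 1 + (k + 1) = n + 1 + k + 1 by ring,
              show n + (k + 1) = n + 1 + k by ring, show 2 * (k + 1) = 2 * k + 1 + 1 by ring,
              Nat.choose_succ_succ]
            push_cast
            ring
          · simp
      _ = _ := by
          rw [hQ, hP']
          simp only [inv_pow]
          field_simp
          ring

theorem choose_mul_choose_add_eq (n l : ℕ) :
    n.choose l * (n + l).choose l = (n + l).choose (2 * l) * (2 * l).choose l := by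
  have h := Nat.choose_mul (n := n + l) (k := 2 * l) (s := l) (by omega)
  rw [h, Nat.add_sub_cancel, two_mul, Nat.add_sub_cancel, mul_comm]

theorem two_mul_choose_succ {K : Type*} [Field K] [CharZero K] (l : ℕ) :
    ((2 * (l + 1)).choose (l + 1) : K) = 2 * (2 * l + 1) / (l + 1) * (2 * l).choose l := by
  have h : ((l : K) + 1) * ((2 * (l + 1)).choose (l + 1) : K) =
      2 * (2 * l + 1) * (2 * l).choose l := by
    exact_mod_cast Nat.succ_mul_centralBinom_succ l
  have hl : (l : K) + 1 ≠ 0 := by exact_mod_cast l.succ_ne_zero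
  field_simp
  linear_combination h

theorem choose_succ_eq_div_mul {K : Type*} [Field K] [CharZero K] (n k : ℕ) :
    (n.choose (k + 1) : K) = (n - k) / (k + 1) * n.choose k := by
  have hk : (k : K) + 1 ≠ 0 := by exact_mod_cast k.succ_ne_zero
  have h := congrArg (Nat.cast : ℕ → K) (Nat.choose_succ_right_eq n k)
  push_cast at h
  rcases le_or_gt k n with hkn | hkn
  · rw [Nat.cast_sub hkn] at h
    field_simp
    linear_combination h
  · rw [Nat.choose_eq_zero_of_lt hkn, Nat.choose_eq_zero_of_lt (by omega)]
    simp

/-- A telescoping form of the sum of two consecutive coefficients of the shifted Legendre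
polynomials. -/
theorem choose_mul_choose_add_succ {K : Type*} [Field K] [CharZero K] (m l : ℕ) :
    (-1 : K) ^ (l + 1) * ((m + 1).choose (l + 1) * (m + 1 + (l + 1)).choose (l + 1)) +
        (-1) ^ (l + 1) * (m.choose (l + 1) * (m + (l + 1)).choose (l + 1)) =
      (-1) ^ (l + 1) * (l + 1) * (2 * (l + 1)).choose (l + 1) *
          (m + 1 + l).choose (2 * l + 1) / (m + 1) -
        (-1) ^ (l + 2) * (l + 2) * (2 * (l + 2)).choose (l + 2) *
          (m + 1 + (l + 1)).choose (2 * (l + 1) + 1) / (m + 1) := by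
  have e1 : ((m + 1).choose (l + 1) : K) * (m + 1 + (l + 1)).choose (l + 1) =
      (m + 1 + (l + 1)).choose (2 * (l + 1)) * (2 * (l + 1)).choose (l + 1) := by
    exact_mod_cast choose_mul_choose_add_eq (m + 1) (l + 1)
  have e2 : (m.choose (l + 1) : K) * (m + (l + 1)).choose (l + 1) =
      (m + (l + 1)).choose (2 * (l + 1)) * (2 * (l + 1)).choose (l + 1) := by
    exact_mod_cast choose_mul_choose_add_eq m (l + 1)
  have e3 : ((l : K) + 2) * (2 * (l + 2)).choose (l + 2) *
        (m + 1 + (l + 1)).choose (2 * (l + 1) + 1) =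
      2 * (m + l + 2) * (2 * (l + 1)).choose (l + 1) * (m + 1 + l).choose (2 * (l + 1)) := by
    have h : ((m : K) + 1 + l + 1) * (m + 1 + l).choose (2 * (l + 1)) =
        (m + 1 + (l + 1)).choose (2 * (l + 1) + 1) * (2 * (l + 1) + 1) := by
      exact_mod_cast Nat.add_one_mul_choose_eq (m + 1 + l) (2 * (l + 1))
    have h' : ((l : K) + 1 + 1) * (2 * (l + 2)).choose (l + 2) =
        2 * (2 * (l + 1) + 1) * (2 * (l + 1)).choose (l + 1) := by
      exact_mod_cast Nat.succ_mul_centralBinom_succ (l + 1)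
    linear_combination ((m + 1 + (l + 1)).choose (2 * (l + 1) + 1) : K) * h' -
      2 * ((2 * (l + 1)).choose (l + 1) : K) * h
  have e5 : ((m + 1 + l).choose (2 * (l + 1)) : K) =
      (m - l) / (2 * l + 2) * (m + 1 + l).choose (2 * l + 1) := by
    have h := choose_succ_eq_div_mul (K := K) (m + 1 + l) (2 * l + 1)
    rw [show 2 * (l + 1) = 2 * l + 1 + 1 by ring, h]
    push_cast
    congr 2 <;> ring
  have e6 : ((m + 1 + (l + 1)).choose (2 * (l + 1)) : K) =
      (m + 1 + l).choose (2 * l + 1) + (m + 1 + l).choose (2 * (l + 1)) := by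
    rw [← add_assoc, show 2 * (l + 1) = 2 * l + 1 + 1 by ring, Nat.choose_succ_succ]
    push_cast
    ring
  have hm : (m : K) + 1 ≠ 0 := by exact_mod_cast m.succ_ne_zero
  rw [mul_assoc (_ * _) _ ((m + 1 + (l + 1)).choose (2 * (l + 1) + 1) : K),
    mul_assoc _ ((l : K) + 2), ← mul_assoc ((l : K) + 2), e3, e1, e2, e6,
    show m + (l + 1) = m + 1 + l by ring, e5]
  generalize ((m + 1 + l).choose (2 * l + 1) : K) = X
  generalize ((2 * (l + 1)).choose (l + 1) : K) = c
  have h1 : (l : K) + 1 ≠ 0 := by exact_mod_cast l.succ_ne_zero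
  have h24 : 2 * (l : K) + 2 = 2 * (l + 1) := by ring
  rw [h24]
  field_simp
  ring

/-- The double sum in closed form, as an exact identity in characteristic zero. -/
theorem sum_choose_mul_choose_add_mul_sum {K : Type*} [Field K] [CharZero K] {t : K}
    (ht : t ≠ 0) (ht1 : t + 1 ≠ 0) {n N : ℕ} (hn : n ≤ N) :
    ∑ l ∈ Finset.Icc 1 N, (-1 : K) ^ l * (n.choose l * (n + l).choose l) *
        ∑ k ∈ Finset.Icc 1 l, (1 / ((k : K) * (2 * k).choose k)) * (-((t - 1) ^ 2 / t)) ^ k =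
      (t - 1) / (t + 1) * (-1) ^ n *
        ∑ j ∈ Finset.Icc 1 n, ((-t) ^ j - (-t⁻¹) ^ j) / j := by
  induction n with
  | zero =>
    simp only [sum_Icc_one_eq_sum_range]
    simp
  | succ n ih =>
    have hm : (n : K) + 1 ≠ 0 := by exact_mod_cast n.succ_ne_zero
    set h : ℕ → K := fun k => (1 / ((k : K) * (2 * k).choose k)) * (-((t - 1) ^ 2 / t)) ^ k
    set G : ℕ → K := fun k => (-1) ^ k * k * (2 * k).choose k * (n + k).choose (2 * k - 1) / (n + 1)
    have hG : ∑ l ∈ Finset.Icc 1 N,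
          (-1 : K) ^ l * ((n + 1).choose l * (n + 1 + l).choose l) * ∑ k ∈ Finset.Icc 1 l, h k +
        ∑ l ∈ Finset.Icc 1 N,
          (-1 : K) ^ l * (n.choose l * (n + l).choose l) * ∑ k ∈ Finset.Icc 1 l, h k =
        ∑ l ∈ Finset.Icc 1 N, (G l - G (l + 1)) * ∑ k ∈ Finset.Icc 1 l, h k := by
      rw [← Finset.sum_add_distrib]
      refine Finset.sum_congr rfl fun l hl => ?_
      obtain ⟨l, rfl⟩ := Nat.exists_eq_add_of_le' (Finset.mem_Icc.1 hl).1
      rw [← add_mul, choose_mul_choose_add_succ]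
      congr 1
      simp only [G]
      rw [show n + (l + 1 + 1) = n + 1 + (l + 1) by ring, show n + (l + 1) = n + 1 + l by ring,
        show 2 * (l + 1) - 1 = 2 * l + 1 by omega,
        show 2 * (l + 1 + 1) - 1 = 2 * (l + 1) + 1 by omega]
      push_cast
      ring
    have hGN : G (N + 1) = 0 := by
      simp only [G]
      rw [Nat.choose_eq_zero_of_lt (show n + (N + 1) < 2 * (N + 1) - 1 by omega)]
      simp
    have hGh : ∑ k ∈ Finset.Icc 1 N, G k * h k =
        (t - 1) / (t + 1) * (t ^ (n + 1) - t⁻¹ ^ (n + 1)) / (n + 1) := by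
      rw [← (sum_choose_mul_sq_div_pow ht ht1 hn).1, sum_Icc_one_eq_sum_range, Finset.sum_div]
      refine Finset.sum_congr rfl fun k _ => ?_
      have hc : ((2 * (k + 1)).choose (k + 1) : K) ≠ 0 := by
        exact_mod_cast (Nat.choose_pos (by omega)).ne'
      have hk : (k : K) + 1 ≠ 0 := by exact_mod_cast k.succ_ne_zero
      simp only [G, h, neg_pow ((t - 1) ^ 2 / t)]
      rw [show n + (k + 1) = n + 1 + k by ring, show 2 * (k + 1) - 1 = 2 * k + 1 by omega]
      have hs : (-1 : K) ^ (k + 1) * (-1) ^ (k + 1) = 1 := by rw [← mul_pow]; simp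
      push_cast
      generalize ((t - 1) ^ 2 / t) ^ (k + 1) = w
      field_simp
      linear_combination (w * ((n + 1 + k).choose (2 * k + 1) : K)) * hs
    rw [sum_sub_succ_mul_sum_Icc, hGN, zero_mul, sub_zero, hGh, ih (by omega)] at hG
    rw [Finset.sum_Icc_succ_top (by omega), eq_sub_of_add_eq hG]
    have hs : (-1 : K) ^ n * (-1) ^ n = 1 := by rw [← mul_pow]; simp
    rw [neg_pow t (n + 1), neg_pow t⁻¹ (n + 1), pow_succ (-1 : K) n]
    push_cast
    linear_combination (t - 1) / (t + 1) * (t⁻¹ ^ (n + 1) - t ^ (n + 1)) / (n + 1) * hs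

theorem Padic.norm_mul_sub_mul_le {p : ℕ} [Fact p.Prime] {a a' b b' : ℚ_[p]} {r : ℝ}
    (ha : ‖a - a'‖ ≤ r) (hb : ‖b - b'‖ ≤ r) (ha1 : ‖a‖ ≤ 1) (hb1 : ‖b'‖ ≤ 1) :
    ‖a * b - a' * b'‖ ≤ r := by
  rw [show a * b - a' * b' = a * (b - b') + (a - a') * b' by ring]
  refine (Padic.nonarchimedean _ _).trans (max_le ?_ ?_) <;> rw [norm_mul]
  · exact (mul_le_of_le_one_left (norm_nonneg _) ha1).trans hb
  · exact (mul_le_of_le_one_right (norm_nonneg _) hb1).trans ha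

theorem Padic.norm_natCast_le_one {p : ℕ} [Fact p.Prime] (a : ℕ) : ‖(a : ℚ_[p])‖ ≤ 1 := by
  exact_mod_cast Padic.norm_int_le_one (p := p) a

theorem Padic.norm_natCast_eq_one_of_not_dvd {p : ℕ} [hp : Fact p.Prime] {a : ℕ} (h : ¬ p ∣ a) :
    ‖(a : ℚ_[p])‖ = 1 :=
  Padic.norm_natCast_eq_one_iff.2 ((Nat.Prime.coprime_iff_not_dvd hp.out).2 h)

theorem Padic.norm_intCast_eq_one_of_not_dvd {p : ℕ} [hp : Fact p.Prime] {a : ℤ}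
    (h : ¬ (p : ℤ) ∣ a) : ‖(a : ℚ_[p])‖ = 1 :=
  (Padic.norm_int_le_one a).eq_of_not_lt (mt Padic.norm_intCast_lt_one_iff.1 h)

section

variable {p : ℕ} [hp : Fact p.Prime] {n : ℕ}

theorem norm_two_mul_succ_eq_one (hn : p = 2 * n + 1) {k : ℕ} (hk : k + 1 < p) :
    ‖(2 : ℚ_[p]) * (k + 1)‖ = 1 := by
  have h : ¬ p ∣ 2 * (k + 1) := by
    rw [hp.out.dvd_mul]
    have := hp.out.two_le
    rintro (h | h) <;> have := Nat.le_of_dvd (by omega) h <;> omega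
  exact_mod_cast Padic.norm_natCast_eq_one_of_not_dvd h

theorem norm_choose_two_mul_div_le_one (hn : p = 2 * n + 1) {k : ℕ} :
    ‖((2 * k).choose k : ℚ_[p]) / 4 ^ k‖ ≤ 1 := by
  have h4 : ‖(4 : ℚ_[p])‖ = 1 := by
    have := norm_two_mul_succ_eq_one hn (k := 1) (by have := hp.out.two_le; omega)
    norm_num at this
    exact this
  rw [norm_div, norm_pow, h4, one_pow, div_one]
  exact Padic.norm_natCast_le_one _

/-- The central binomial coefficients modulo `p`, by comparing ratios of consecutive terms. -/
theorem norm_choose_two_mul_div_sub_le (hn : p = 2 * n + 1) {f : ℕ → ℚ_[p]} {g : ℕ → ℚ_[p]}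
    (hf0 : f 0 = 1) (hf : ∀ k, ‖f k‖ ≤ 1) (hfg : ∀ k, f (k + 1) = g k / (2 * (k + 1)) * f k)
    (hg : ∀ k : ℕ, ‖(2 * k + 1 : ℚ_[p]) - g k‖ ≤ (p : ℝ)⁻¹) {k : ℕ} (hk : k < p) :
    ‖((2 * k).choose k : ℚ_[p]) / 4 ^ k - f k‖ ≤ (p : ℝ)⁻¹ := by
  induction k with
  | zero => simp [hf0]
  | succ k ih =>
    have hu := norm_two_mul_succ_eq_one hn hk
    have hk1 : (k : ℚ_[p]) + 1 ≠ 0 := by exact_mod_cast k.succ_ne_zero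
    have e : ((2 * (k + 1)).choose (k + 1) : ℚ_[p]) / 4 ^ (k + 1) =
        (2 * k + 1) / (2 * (k + 1)) * ((2 * k).choose k / 4 ^ k) := by
      rw [two_mul_choose_succ]
      field_simp
      ring
    rw [e, hfg]
    refine Padic.norm_mul_sub_mul_le ?_ (ih (by omega)) ?_ (hf k)
    · rw [← sub_div, norm_div, hu, div_one]
      exact hg k
    · rw [norm_div, hu, div_one]
      exact_mod_cast Padic.norm_natCast_le_one (2 * k + 1)

theorem norm_choose_two_mul_div_sub_neg_one_pow_mul_choose_le (hn : p = 2 * n + 1) {k : ℕ}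
    (hk : k < p) :
    ‖((2 * k).choose k : ℚ_[p]) / 4 ^ k - (-1) ^ k * n.choose k‖ ≤ (p : ℝ)⁻¹ := by
  refine norm_choose_two_mul_div_sub_le hn (f := fun k => (-1) ^ k * n.choose k)
    (g := fun k => -(2 * (n - k))) (by simp) (fun k => ?_) (fun k => ?_) (fun k => ?_) hk
  · simpa using Padic.norm_natCast_le_one (n.choose k)
  · have hk1 : (k : ℚ_[p]) + 1 ≠ 0 := by exact_mod_cast k.succ_ne_zero
    rw [choose_succ_eq_div_mul]
    field_simp
    ring
  · have hp' : (p : ℚ_[p]) = 2 * n + 1 := by exact_mod_cast congrArg (Nat.cast (R := ℚ_[p])) hn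
    rw [show (2 * k + 1 : ℚ_[p]) - -(2 * (n - k)) = p by rw [hp']; ring]
    simp

theorem norm_choose_two_mul_div_sub_choose_add_le (hn : p = 2 * n + 1) {k : ℕ} (hk : k < p) :
    ‖((2 * k).choose k : ℚ_[p]) / 4 ^ k - (n + k).choose k‖ ≤ (p : ℝ)⁻¹ := by
  refine norm_choose_two_mul_div_sub_le hn (f := fun k => (n + k).choose k)
    (g := fun k => 2 * (n + k + 1)) (by simp) (fun k => ?_) (fun k => ?_) (fun k => ?_) hk
  · exact Padic.norm_natCast_le_one _
  · have hk1 : (k : ℚ_[p]) + 1 ≠ 0 := by exact_mod_cast k.succ_ne_zero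
    have h : ((n : ℚ_[p]) + k + 1) * (n + k).choose k =
        (n + (k + 1)).choose (k + 1) * (k + 1) := by
      exact_mod_cast Nat.add_one_mul_choose_eq (n + k) k
    field_simp
    linear_combination -h
  · have hp' : (p : ℚ_[p]) = 2 * n + 1 := by exact_mod_cast congrArg (Nat.cast (R := ℚ_[p])) hn
    rw [show (2 * k + 1 : ℚ_[p]) - 2 * (n + k + 1) = -p by rw [hp']; ring]
    simp

theorem norm_Ssum_sub_le (hn : p = 2 * n + 1) {x : ℚ_[p]} (hx : ‖4 * x‖ ≤ 1) :
    ‖Ssum p x - ∑ j ∈ Finset.Icc 1 n, ((1 - 4 * x) ^ j - 1) / j‖ ≤ (p : ℝ)⁻¹ := by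
  rw [Ssum, ← sum_choose_mul_neg_pow_div (4 * x) (show n ≤ p - 1 by omega),
    ← Finset.sum_sub_distrib]
  refine IsUltrametricDist.norm_sum_le_of_forall_le_of_nonneg (by positivity) fun k hk => ?_
  rw [Finset.mem_Icc] at hk
  have hk1 : ‖(k : ℚ_[p])‖ = 1 := Padic.norm_natCast_eq_one_of_not_dvd fun h => by
    have := Nat.le_of_dvd (by omega) h
    omega
  rw [← sub_div, norm_div, hk1, div_one,
    show ((2 * k).choose k : ℚ_[p]) * x ^ k = (2 * k).choose k / 4 ^ k * (4 * x) ^ k by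
      rw [mul_pow]; field_simp,
    ← sub_mul, norm_mul, norm_pow]
  exact (mul_le_of_le_one_right (norm_nonneg _) (pow_le_one₀ (norm_nonneg _) hx)).trans
    (norm_choose_two_mul_div_sub_neg_one_pow_mul_choose_le hn (by omega))

theorem norm_sum_inv_choose_two_mul_le_one (hn : p = 2 * n + 1) {z : ℚ_[p]} (hz : ‖z‖ ≤ 1)
    {l : ℕ} (hl : l ≤ n) :
    ‖∑ k ∈ Finset.Icc 1 l, (1 / ((k : ℚ_[p]) * ((2 * k).choose k : ℚ_[p]))) * z ^ k‖ ≤ 1 := by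
  refine IsUltrametricDist.norm_sum_le_of_forall_le_of_nonneg zero_le_one fun k hk => ?_
  rw [Finset.mem_Icc] at hk
  have h : ¬ p ∣ k * (2 * k).choose k := by
    rw [hp.out.dvd_mul]
    rintro (h | h)
    · have := Nat.le_of_dvd (by omega) h
      omega
    · have h' := (hp.out.dvd_factorial).1 (h.trans (Nat.choose_mul_factorial_mul_factorial
        (show k ≤ 2 * k by omega) ▸ (dvd_mul_right _ _).trans (dvd_mul_right _ _)))
      omega
  have hu : ‖(k : ℚ_[p]) * ((2 * k).choose k : ℚ_[p])‖ = 1 := by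
    exact_mod_cast Padic.norm_natCast_eq_one_of_not_dvd h
  rw [norm_mul, norm_div, hu, norm_one, div_one, one_mul, norm_pow]
  exact pow_le_one₀ (norm_nonneg _) hz

theorem norm_sum_choose_two_mul_sq_sub_le (hn : p = 2 * n + 1) {z : ℚ_[p]} (hz : ‖z‖ ≤ 1) :
    ‖(∑ l ∈ Finset.Icc 1 n, (((2 * l).choose l : ℚ_[p]) ^ 2 / (16 : ℚ_[p]) ^ l) *
          ∑ k ∈ Finset.Icc 1 l, (1 / ((k : ℚ_[p]) * ((2 * k).choose k : ℚ_[p]))) * z ^ k) -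
        ∑ l ∈ Finset.Icc 1 n, (-1 : ℚ_[p]) ^ l * (n.choose l * (n + l).choose l) *
          ∑ k ∈ Finset.Icc 1 l, (1 / ((k : ℚ_[p]) * ((2 * k).choose k : ℚ_[p]))) * z ^ k‖ ≤
      (p : ℝ)⁻¹ := by
  rw [← Finset.sum_sub_distrib]
  refine IsUltrametricDist.norm_sum_le_of_forall_le_of_nonneg (by positivity) fun l hl => ?_
  rw [Finset.mem_Icc] at hl
  rw [← sub_mul, norm_mul]
  refine (mul_le_of_le_one_right (norm_nonneg _)
    (norm_sum_inv_choose_two_mul_le_one hn hz hl.2)).trans ?_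
  rw [show ((2 * l).choose l : ℚ_[p]) ^ 2 / 16 ^ l =
      (2 * l).choose l / 4 ^ l * ((2 * l).choose l / 4 ^ l) by
    rw [show (16 : ℚ_[p]) = 4 * 4 by norm_num, mul_pow]; field_simp, ← mul_assoc]
  exact Padic.norm_mul_sub_mul_le
    (norm_choose_two_mul_div_sub_neg_one_pow_mul_choose_le hn (by omega))
    (norm_choose_two_mul_div_sub_choose_add_le hn (by omega))
    (norm_choose_two_mul_div_le_one hn) (Padic.norm_natCast_le_one _)

end

theorem sum_central_binom_double_sum (p : ℕ) [Fact p.Prime] (hodd : Odd p)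
    (m d : ℤ) (hpmd : ¬ (p : ℤ) ∣ m * d * (m + d)) :
    ‖(∑ l ∈ Finset.Icc 1 ((p - 1) / 2),
        (((2 * l).choose l : ℚ_[p]) ^ 2 / (16 : ℚ_[p]) ^ l) *
          ∑ k ∈ Finset.Icc 1 l,
            (1 / ((k : ℚ_[p]) * ((2 * k).choose k : ℚ_[p]))) *
              (-((m : ℚ_[p]) - (d : ℚ_[p])) ^ 2 / ((m : ℚ_[p]) * (d : ℚ_[p]))) ^ k) -
      (((d : ℚ_[p]) - (m : ℚ_[p])) / ((d : ℚ_[p]) + (m : ℚ_[p]))) *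
        (-1 : ℚ_[p]) ^ ((p - 1) / 2) *
        (Ssum p (((m : ℚ_[p]) + (d : ℚ_[p])) / (4 * (m : ℚ_[p]))) -
          Ssum p (((m : ℚ_[p]) + (d : ℚ_[p])) / (4 * (d : ℚ_[p]))))‖ ≤
      (p : ℝ)⁻¹ := by
  obtain ⟨n, hn⟩ := hodd
  rw [show (p - 1) / 2 = n by omega]
  have hm : ‖(m : ℚ_[p])‖ = 1 := Padic.norm_intCast_eq_one_of_not_dvd fun h =>
    hpmd ((h.mul_right d).mul_right _)
  have hd : ‖(d : ℚ_[p])‖ = 1 := Padic.norm_intCast_eq_one_of_not_dvd fun h =>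
    hpmd ((h.mul_left m).mul_right _)
  have hdm : ‖(d : ℚ_[p]) + m‖ = 1 := by
    exact_mod_cast Padic.norm_intCast_eq_one_of_not_dvd (p := p) (a := d + m) fun h =>
      hpmd ((add_comm d m ▸ h).mul_left _)
  have hm0 : (m : ℚ_[p]) ≠ 0 := norm_ne_zero_iff.1 (by simp [hm])
  have hd0 : (d : ℚ_[p]) ≠ 0 := norm_ne_zero_iff.1 (by simp [hd])
  have hdm0 : (d : ℚ_[p]) + m ≠ 0 := norm_ne_zero_iff.1 (by simp [hdm])
  have hsub : ‖(d : ℚ_[p]) - m‖ ≤ 1 := by exact_mod_cast Padic.norm_int_le_one (p := p) (d - m)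
  set t : ℚ_[p] := d / m with ht_def
  have ht : t ≠ 0 := div_ne_zero hd0 hm0
  have ht1 : t + 1 ≠ 0 := by
    rw [ht_def, div_add_one hm0]
    exact div_ne_zero hdm0 hm0
  have hz : -((m : ℚ_[p]) - d) ^ 2 / (m * d) = -((t - 1) ^ 2 / t) := by
    rw [ht_def]
    field_simp
    ring
  have hz1 : ‖-((m : ℚ_[p]) - d) ^ 2 / (m * d)‖ ≤ 1 := by
    rw [norm_div, norm_neg, norm_pow, norm_mul, hm, hd, mul_one, div_one, norm_sub_rev]
    exact pow_le_one₀ (norm_nonneg _) hsub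
  have hc : ((d : ℚ_[p]) - m) / (d + m) = (t - 1) / (t + 1) := by
    rw [ht_def]
    field_simp
  have hc1 : ‖((d : ℚ_[p]) - m) / (d + m) * (-1) ^ n‖ ≤ 1 := by
    simpa [hdm] using hsub
  have hx : 4 * (((m : ℚ_[p]) + d) / (4 * m)) = 1 + t := by
    rw [ht_def]
    field_simp
  have hy : 4 * (((m : ℚ_[p]) + d) / (4 * d)) = 1 + t⁻¹ := by
    rw [ht_def]
    field_simp
    ring
  have hx1 : ‖4 * (((m : ℚ_[p]) + d) / (4 * m))‖ ≤ 1 := by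
    rw [show 4 * (((m : ℚ_[p]) + d) / (4 * m)) = (d + m) / m by field_simp; ring]
    simp [hdm, hm]
  have hy1 : ‖4 * (((m : ℚ_[p]) + d) / (4 * d))‖ ≤ 1 := by
    rw [show 4 * (((m : ℚ_[p]) + d) / (4 * d)) = (d + m) / d by field_simp; ring]
    simp [hdm, hd]
  have hL := norm_sum_choose_two_mul_sq_sub_le hn hz1
  have hX := norm_Ssum_sub_le hn hx1
  have hY := norm_Ssum_sub_le hn hy1
  rw [hx] at hX
  rw [hy] at hY
  rw [hz, sum_choose_mul_choose_add_mul_sum ht ht1 le_rfl, ← hz, ← hc] at hL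
  set A := ∑ j ∈ Finset.Icc 1 n, ((1 - (1 + t)) ^ j - 1) / (j : ℚ_[p]) with hA
  set B := ∑ j ∈ Finset.Icc 1 n, ((1 - (1 + t⁻¹)) ^ j - 1) / (j : ℚ_[p]) with hB
  have hAB : ∑ j ∈ Finset.Icc 1 n, ((-t) ^ j - (-t⁻¹) ^ j) / (j : ℚ_[p]) = A - B := by
    rw [hA, hB, ← Finset.sum_sub_distrib]
    refine Finset.sum_congr rfl fun j _ => ?_
    rw [← sub_div]
    congr 1
    ring
  rw [hAB] at hL
  set c := ((d : ℚ_[p]) - m) / (d + m) * (-1) ^ n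
  set X := Ssum p (((m : ℚ_[p]) + d) / (4 * m))
  set Y := Ssum p (((m : ℚ_[p]) + d) / (4 * d))
  have key : ∀ L, ‖L - c * (A - B)‖ ≤ (p : ℝ)⁻¹ → ‖L - c * (X - Y)‖ ≤ (p : ℝ)⁻¹ := by
    intro L hL
    rw [show L - c * (X - Y) = (L - c * (A - B)) + c * ((Y - B) + -(X - A)) by ring]
    refine (Padic.nonarchimedean _ _).trans (max_le hL ?_)
    rw [norm_mul]
    refine (mul_le_of_le_one_left (norm_nonneg _) hc1).trans
      ((Padic.nonarchimedean _ _).trans (max_le hY ?_))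
    rwa [norm_neg]
  exact key _ hL
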